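/- The image under inc of the kernel of div equals the kernel of pic; that is, inc(ker(div)) = ker(pic). In the paper's notation this says that for the labelled McKay quiver of sections, the subgroup R := inc(ker(div)) of the weight lattice coincides with ker(pic). -/

import Mathlib

/-!
McKay quiver setup: `A` a finite abelian group, `κ : Fin n → A` with image generating
`A`. `F` is the free abelian group on the nonzero elements of `A` (with `e 0 = 0`),
`inc : ℤ^{A × Fin n} →+ F` sends `e (a, i) ↦ e (a + κ i) - e a`,
`div : ℤ^{A × Fin n} →+ ℤ^{Fin n}` sends `e (a, i) ↦ e i`, and `pic : F →+ A`
sends `e a ↦ a`.  Then `inc (ker div) = ker pic`, i.e. `R = ker pic`.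
-/

/-- Basis element of the free abelian group on the nonzero elements of `A`,
with the convention `e 0 = 0`. -/
noncomputable def e {A : Type*} [AddCommGroup A] [DecidableEq A] (a : A) :
    ({x : A // x ≠ 0} →₀ ℤ) :=
  if h : a = 0 then 0 else Finsupp.single ⟨a, h⟩ 1

/-- The homomorphism `pic : F →+ A` determined by `pic (e a) = a` for `a ≠ 0`. -/
noncomputable def pic (A : Type*) [AddCommGroup A] : ({x : A // x ≠ 0} →₀ ℤ) →+ A :=
  Finsupp.liftAddHom fun s => zmultiplesHom A s.val

/-- The incidence map of the McKay quiver: `e (a, i) ↦ e (a + κ i) - e a`. -/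
noncomputable def inc {A : Type*} [AddCommGroup A] [DecidableEq A] {n : ℕ}
    (κ : Fin n → A) : (A × Fin n →₀ ℤ) →+ ({x : A // x ≠ 0} →₀ ℤ) :=
  Finsupp.liftAddHom fun p => zmultiplesHom _ (e (p.1 + κ p.2) - e p.1)

/-- The labelling map of the McKay quiver: `e (a, i) ↦ e i`. -/
noncomputable def dv (A : Type*) [AddCommGroup A] (n : ℕ) :
    (A × Fin n →₀ ℤ) →+ (Fin n →₀ ℤ) :=
  Finsupp.mapDomain.addMonoidHom Prod.snd

theorem e_zero' {A : Type*} [AddCommGroup A] [DecidableEq A] : e (0 : A) = 0 := by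
  simp [e]

theorem e_ne' {A : Type*} [AddCommGroup A] [DecidableEq A] (s : {x : A // x ≠ 0}) :
    e s.val = Finsupp.single s 1 := by
  simp [e, s.2]

theorem pic_e' {A : Type*} [AddCommGroup A] [DecidableEq A] (a : A) : pic A (e a) = a := by
  by_cases h : a = 0
  · subst h; simp [e]
  · simp [e, h, pic]

theorem inc_single' {A : Type*} [AddCommGroup A] [DecidableEq A] {n : ℕ} (κ : Fin n → A)
    (a : A) (i : Fin n) : inc κ (Finsupp.single (a, i) 1) = e (a + κ i) - e a := by
  simp [inc]

theorem dv_single' {A : Type*} [AddCommGroup A] {n : ℕ}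
    (a : A) (i : Fin n) : dv A n (Finsupp.single (a, i) 1) = Finsupp.single i 1 := by
  simp [dv]

theorem pic_inc' {A : Type*} [AddCommGroup A] [DecidableEq A] {n : ℕ} (κ : Fin n → A) :
    (pic A).comp (inc κ) =
      (Finsupp.liftAddHom fun i => zmultiplesHom A (κ i)).comp (dv A n) := by
  refine Finsupp.addHom_ext' fun p => ?_
  refine AddMonoidHom.ext_int ?_
  obtain ⟨a, i⟩ := p
  simp only [AddMonoidHom.comp_apply, Finsupp.singleAddHom_apply, inc_single', dv_single',
    map_sub, pic_e']
  simp

theorem e_add_mem' {A : Type*} [AddCommGroup A] [DecidableEq A] {n : ℕ} (κ : Fin n → A)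
    (hκ : AddSubgroup.closure (Set.range κ) = ⊤) (b : A) :
    ∀ a : A, e (a + b) - e a - e b ∈ AddSubgroup.map (inc κ) (dv A n).ker := by
  have hb : b ∈ AddSubgroup.closure (Set.range κ) := by rw [hκ]; trivial
  induction hb using AddSubgroup.closure_induction with
  | mem x hx =>
    obtain ⟨i, rfl⟩ := hx
    intro a
    refine ⟨Finsupp.single (a, i) 1 - Finsupp.single (0, i) 1, ?_, ?_⟩
    · change dv A n _ = 0
      rw [map_sub, dv_single', dv_single', sub_self]
    · rw [map_sub, inc_single', inc_single', e_zero', zero_add, sub_zero]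
  | zero => intro a; simp [e_zero']
  | add b c _ _ ihb ihc =>
    intro a
    have h := sub_mem (add_mem (ihc (a + b)) (ihb a)) (ihc b)
    convert h using 1
    rw [add_assoc]
    abel
  | neg b _ ih =>
    intro a
    have h := sub_mem (ih (-b)) (ih (a + -b))
    rw [neg_add_cancel_right, neg_add_cancel, e_zero'] at h
    convert h using 1
    abel

theorem inc_ker_div_eq_ker_pic {A : Type*} [AddCommGroup A] [Fintype A] [DecidableEq A]
    {n : ℕ} (hn : 1 ≤ n) (κ : Fin n → A)
    (hκ : AddSubgroup.closure (Set.range κ) = ⊤) :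
    AddSubgroup.map (inc κ) (dv A n).ker = (pic A).ker := by
  apply le_antisymm
  · rintro _ ⟨x, hx, rfl⟩
    have hx0 : dv A n x = 0 := hx
    change pic A (inc κ x) = 0
    have h := DFunLike.congr_fun (pic_inc' κ) x
    simp only [AddMonoidHom.comp_apply, hx0, map_zero] at h
    exact h
  · intro x hx
    have hx0 : pic A x = 0 := hx
    set R := AddSubgroup.map (inc κ) (dv A n).ker with hR
    let φ : A →+ (({x : A // x ≠ 0} →₀ ℤ) ⧸ R) := AddMonoidHom.mk'
      (fun a => QuotientAddGroup.mk' R (e a)) (by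
        intro a b
        have h := (QuotientAddGroup.eq_zero_iff (N := R) _).2 (e_add_mem' κ hκ b a)
        change QuotientAddGroup.mk' R _ = 0 at h
        rw [map_sub, map_sub, sub_sub, sub_eq_zero] at h
        exact h)
    have hφ : φ.comp (pic A) = QuotientAddGroup.mk' R := by
      refine Finsupp.addHom_ext' fun s => ?_
      refine AddMonoidHom.ext_int ?_
      simp only [AddMonoidHom.comp_apply, Finsupp.singleAddHom_apply]
      rw [← e_ne', pic_e']
      rfl
    have h := DFunLike.congr_fun hφ x
    rw [AddMonoidHom.comp_apply, hx0, map_zero] at h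
    exact (QuotientAddGroup.eq_zero_iff (N := R) x).1 h.symm
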